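/- Let a > 0 and let x : ℤ → ℝ → ℝ be a family of differentiable functions of time t with x_{i+1}(t) > x_i(t) for all i ∈ ℤ and all t. Define μ_i(t) = a²/(x_{i+1}(t) − x_i(t))³ − a²/(x_i(t) − x_{i-1}(t))³ and u_i(t) = a/(x_{i+1}(t) − x_i(t)), and suppose each x_i satisfies the attachment-detachment-limited step-flow ODE ẋ_i(t) = (1/a²)(μ_{i+1}(t) − 2μ_i(t) + μ_{i-1}(t)). Then each u_i is differentiable and satisfies u̇_i = −(1/a⁴)·u_i²·[(u_{i+2}³ − 2u_{i+1}³ + u_i³) − 2(u_{i+1}³ − 2u_i³ + u_{i-1}³) + (u_i³ − 2u_{i-1}³ + u_{i-2}³)]. -/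

import Mathlib

/-- From the ADL step-flow ODE `ẋ_i = (1/a²)(μ_{i+1} − 2μ_i + μ_{i-1})` with chemical
potential `μ_i = a²/(x_{i+1}−x_i)³ − a²/(x_i−x_{i-1})³` and slopes
`u_i = a/(x_{i+1}−x_i)`, each `u_i` satisfies the slope ODE, whose right-hand side
involves the fourth centered difference of `u_j³`. -/
theorem slope_ode_from_step_flow
    (a : ℝ) (ha : 0 < a)
    (x : ℤ → ℝ → ℝ)
    (hmono : ∀ (i : ℤ) (t : ℝ), x i t < x (i + 1) t)
    (μ : ℤ → ℝ → ℝ)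
    (hμ : ∀ (i : ℤ) (t : ℝ),
      μ i t = a ^ 2 / (x (i + 1) t - x i t) ^ 3 - a ^ 2 / (x i t - x (i - 1) t) ^ 3)
    (u : ℤ → ℝ → ℝ)
    (hu : ∀ (i : ℤ) (t : ℝ), u i t = a / (x (i + 1) t - x i t))
    (hode : ∀ (i : ℤ) (t : ℝ),
      HasDerivAt (x i) ((1 / a ^ 2) * (μ (i + 1) t - 2 * μ i t + μ (i - 1) t)) t) :
    ∀ (i : ℤ) (t : ℝ),
      HasDerivAt (u i)
        (-(1 / a ^ 4) * (u i t) ^ 2 *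
          (((u (i + 2) t) ^ 3 - 2 * (u (i + 1) t) ^ 3 + (u i t) ^ 3)
            - 2 * ((u (i + 1) t) ^ 3 - 2 * (u i t) ^ 3 + (u (i - 1) t) ^ 3)
            + ((u i t) ^ 3 - 2 * (u (i - 1) t) ^ 3 + (u (i - 2) t) ^ 3))) t := by
  have hμu : ∀ (i : ℤ) (t : ℝ), μ i t = (1 / a) * ((u i t) ^ 3 - (u (i - 1) t) ^ 3) := by
    intro i t
    rw [hμ, hu, hu, sub_add_cancel, div_pow, div_pow]
    field_simp
  intro i t
  have hd : x (i + 1) t - x i t ≠ 0 := (sub_pos.mpr (hmono i t)).ne'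
  have hui : u i = fun s => a / (x (i + 1) s - x i s) := funext (hu i)
  have h := (hasDerivAt_const t a).fun_div ((hode (i + 1) t).fun_sub (hode i t)) hd
  rw [← hui] at h
  refine h.congr_deriv (Eq.symm ?_)
  have hsq : (u i t) ^ 2 = a ^ 2 / (x (i + 1) t - x i t) ^ 2 := by rw [hu, div_pow]
  rw [hsq]
  simp only [hμu, show i + 1 + 1 = i + 2 by ring, show i + 2 - 1 = i + 1 by ring,
    show i - 1 - 1 = i - 2 by ring, add_sub_cancel_right]
  field_simp
  ring
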